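/- arXiv:2212.08808 — 2 statements merged into one kernel-verified Lean document; each statement's English description precedes it below -/
import Mathlib

section
/- Given any influence network G(W) on node set V and any initial state x(0) ∈ ℝ^n, with respect to the i.i.d. uniform random update sequence, almost surely the trajectory x(t) of the weighted-median opinion dynamics converges to an equilibrium x* in finite time, i.e., there exists a finite T with x(T) = x* an equilibrium and x(t) = x* for all t ≥ T. -/
open Finset MeasureTheory

/-- `m` is a weighted median of `x` associated with the weights `w`. -/
def IsWMedian {V : Type*} [Fintype V] (x w : V → ℝ) (m : ℝ) : Prop :=
  (∃ i, x i = m) ∧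
    (∑ i ∈ Finset.univ.filter (fun i => x i < m), w i) ≤ 1 / 2 ∧
    (∑ i ∈ Finset.univ.filter (fun i => m < x i), w i) ≤ 1 / 2

/-- `W` is a row-stochastic matrix. -/
def RowStochastic {V : Type*} [Fintype V] (W : V → V → ℝ) : Prop :=
  (∀ i j, 0 ≤ W i j) ∧ ∀ i, ∑ j, W i j = 1

open Classical in
/-- `Med W x i` : the weighted median of `x` w.r.t. the weights of row `i` of `W`;
if it is not unique, the weighted median closest to `x i`. -/
noncomputable def Med {V : Type*} [Fintype V] (W : V → V → ℝ) (x : V → ℝ) (i : V) : ℝ :=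
  if h : ∃ m, IsWMedian x (W i) m ∧ ∀ m', IsWMedian x (W i) m' → |m - x i| ≤ |m' - x i| then
    h.choose
  else x i

/-- Trajectory of the weighted-median opinion dynamics: at step `t → t+1` the node `u t`
updates its opinion to its weighted median, all other opinions stay unchanged. -/
noncomputable def traj {V : Type*} [Fintype V] [DecidableEq V]
    (W : V → V → ℝ) (u : ℕ → V) (x0 : V → ℝ) : ℕ → V → ℝ
  | 0 => x0
  | t + 1 => Function.update (traj W u x0 t) (u t) (Med W (traj W u x0 t) (u t))

def IsEquilibrium {V : Type*} [Fintype V] (W : V → V → ℝ) (x : V → ℝ) : Prop :=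
  ∀ i, Med W x i = x i

/-- `M` is a cohesive set. -/
def Cohesive {V : Type*} [Fintype V] (W : V → V → ℝ) (M : Finset V) : Prop :=
  ∀ i ∈ M, 1 / 2 ≤ ∑ j ∈ M, W i j

/-- `M` is a maximal cohesive set. -/
def MaxCohesive {V : Type*} [Fintype V] (W : V → V → ℝ) (M : Finset V) : Prop :=
  Cohesive W M ∧ ∀ i ∉ M, ¬ (1 / 2 < ∑ j ∈ M, W i j)

/-- One step of the cohesive-expansion process: add one node `i` outside the current
set whose total weight on the current set exceeds 1/2. -/
def ExpStep {V : Type*} [Fintype V] [DecidableEq V] (W : V → V → ℝ) (A B : Finset V) : Prop :=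
  ∃ i ∉ A, 1 / 2 < ∑ j ∈ A, W i j ∧ B = insert i A

/-- `E` is a cohesive expansion of `M`: obtained from `M` by repeatedly adding nodes,
until no further node can be added. -/
def IsExpansion {V : Type*} [Fintype V] [DecidableEq V] (W : V → V → ℝ) (M E : Finset V) : Prop :=
  Relation.ReflTransGen (ExpStep W) M E ∧ ∀ i ∉ E, ¬ (1 / 2 < ∑ j ∈ E, W i j)

/-- `(i,j)` is a decisive out-link of `i`. -/
def Decisive {V : Type*} [Fintype V] [DecidableEq V] (W : V → V → ℝ) (i j : V) : Prop :=
  ∃ θ : Finset V, (∀ k ∈ θ, W i k ≠ 0) ∧ j ∈ θ ∧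
    1 / 2 < ∑ k ∈ θ, W i k ∧ (∑ k ∈ θ.erase j, W i k) < 1 / 2

/-- `μ` is the law of the i.i.d. uniform random update sequence, characterized via its
finite-dimensional cylinder probabilities. -/
def IIDUniform {n : ℕ} (μ : Measure (ℕ → Fin n)) : Prop :=
  IsProbabilityMeasure μ ∧
    ∀ (s : Finset ℕ) (g : ℕ → Fin n),
      μ {u | ∀ t ∈ s, u t = g t} = (1 / (n : ENNReal)) ^ s.card

lemma exists_isWMedian {V : Type*} [Fintype V] [Nonempty V] (x w : V → ℝ)
    (hw : ∀ i, 0 ≤ w i) (hsum : ∑ i, w i = 1) : ∃ m, IsWMedian x w m := by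
  classical
  have compl : ∀ v, (∑ i with x i < v, w i) + ∑ i with v ≤ x i, w i = 1 := by
    intro v
    rw [← hsum, ← Finset.sum_filter_add_sum_filter_not univ (fun i => x i < v)]
    simp only [not_lt]
  let s : Finset V := {j | 1 / 2 ≤ ∑ i with x j ≤ x i, w i}
  obtain ⟨a, -, ha⟩ := Finset.exists_min_image univ x univ_nonempty
  have hs : s.Nonempty := by
    refine ⟨a, ?_⟩
    simp only [s, mem_filter, mem_univ, true_and]
    rw [Finset.filter_true_of_mem (fun i hi => ha i hi), hsum]
    norm_num
  obtain ⟨j, hj, hmax⟩ := Finset.exists_max_image s x hs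
  simp only [s, mem_filter, mem_univ, true_and] at hj hmax
  refine ⟨x j, ⟨j, rfl⟩, by linarith [compl (x j)], ?_⟩
  by_contra! hlt
  have hne : (univ.filter fun i => x j < x i).Nonempty := by
    by_contra h
    rw [Finset.not_nonempty_iff_eq_empty] at h
    rw [h, Finset.sum_empty] at hlt
    linarith
  obtain ⟨k, hk, hkmin⟩ := Finset.exists_min_image _ x hne
  simp only [mem_filter, mem_univ, true_and] at hk hkmin
  refine absurd (hmax k ?_) (not_le.mpr hk)
  refine hlt.le.trans (Finset.sum_le_sum_of_subset_of_nonneg ?_ fun i _ _ => hw i)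
  intro i hi
  simp only [mem_filter, mem_univ, true_and] at hi ⊢
  exact hkmin i hi

/-- `Med W x i` is a weighted median, and no weighted median is closer to `x i`. -/
lemma Med_spec {V : Type*} [Fintype V] {W : V → V → ℝ} (hW : RowStochastic W)
    (x : V → ℝ) (i : V) :
    IsWMedian x (W i) (Med W x i) ∧
      ∀ m, IsWMedian x (W i) m → |Med W x i - x i| ≤ |m - x i| := by
  have : Nonempty V := ⟨i⟩
  have hfin : {m | IsWMedian x (W i) m}.Finite :=
    (Set.finite_range x).subset fun m hm => hm.1
  have h : ∃ m, IsWMedian x (W i) m ∧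
      ∀ m', IsWMedian x (W i) m' → |m - x i| ≤ |m' - x i| :=
    Set.exists_min_image _ (fun m => |m - x i|) hfin
      (exists_isWMedian x (W i) (hW.1 i) (hW.2 i))
  rw [Med, dif_pos h]
  exact h.choose_spec

/-- The weighted median commutes with thresholding. -/
lemma le_Med_iff {V : Type*} [Fintype V] {W : V → V → ℝ} (hW : RowStochastic W)
    (x : V → ℝ) (i : V) (θ : ℝ) :
    θ ≤ Med W x i ↔ 1 / 2 < ∑ j with θ ≤ x j, W i j ∨
      (1 / 2 ≤ ∑ j with θ ≤ x j, W i j ∧ θ ≤ x i) := by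
  obtain ⟨⟨-, hlow, hhigh⟩, hclose⟩ := Med_spec hW x i
  set m := Med W x i
  have compl : (∑ j with x j < θ, W i j) + ∑ j with θ ≤ x j, W i j = 1 := by
    rw [← hW.2 i, ← Finset.sum_filter_add_sum_filter_not univ (fun j => x j < θ)]
    simp only [not_lt]
  have mono : ∀ p q : V → Prop, ∀ [DecidablePred p] [DecidablePred q], (∀ j, p j → q j) →
      ∑ j with p j, W i j ≤ ∑ j with q j, W i j := fun p q _ _ hpq =>
    Finset.sum_le_sum_of_subset_of_nonneg
      (fun j hj => by simp only [mem_filter, mem_univ, true_and] at hj ⊢; exact hpq j hj)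
      fun j _ _ => hW.1 i j
  constructor
  · intro hθ
    have hlt := mono (fun j => x j < θ) (fun j => x j < m) fun j hj => hj.trans_le hθ
    have hge : 1 / 2 ≤ ∑ j with θ ≤ x j, W i j := by linarith
    rcases hge.lt_or_eq with h | h
    · exact Or.inl h
    refine Or.inr ⟨hge, ?_⟩
    by_contra! hi
    obtain ⟨k, hk, hkmax⟩ := Finset.exists_max_image (univ.filter fun j => x j < θ) x
      ⟨i, by simpa using hi⟩
    simp only [mem_filter, mem_univ, true_and] at hk hkmax
    have hmed : IsWMedian x (W i) (x k) := by
      refine ⟨⟨k, rfl⟩, ?_, ?_⟩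
      · have := mono (fun j => x j < x k) (fun j => x j < θ) fun j hj => hj.trans hk
        linarith
      · have := mono (fun j => x k < x j) (fun j => θ ≤ x j) fun j hj =>
          not_lt.mp fun hj' => (hkmax j hj').not_gt hj
        linarith
    have := hclose _ hmed
    rw [abs_of_nonneg (by linarith), abs_of_nonneg (by linarith [hkmax i hi])] at this
    linarith
  · intro h
    by_contra! hm
    have hgt := mono (fun j => θ ≤ x j) (fun j => m < x j) fun j hj => hm.trans_le hj
    rcases h with h | ⟨h, hi⟩
    · linarith
    obtain ⟨k, hk, hkmin⟩ := Finset.exists_min_image (univ.filter fun j => θ ≤ x j) x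
      ⟨i, by simpa using hi⟩
    simp only [mem_filter, mem_univ, true_and] at hk hkmin
    have hmed : IsWMedian x (W i) (x k) := by
      refine ⟨⟨k, rfl⟩, ?_, ?_⟩
      · have := mono (fun j => x j < x k) (fun j => x j < θ) fun j hj =>
          not_le.mp fun hj' => (hkmin j hj').not_gt hj
        linarith
      · have := mono (fun j => x k < x j) (fun j => θ ≤ x j) fun j hj => hk.trans hj.le
        linarith
    have := hclose _ hmed
    rw [abs_of_nonpos (by linarith), abs_of_nonpos (by linarith [hkmin i hi])] at this
    linarith

lemma Med_mono {V : Type*} [Fintype V] {W : V → V → ℝ} (hW : RowStochastic W)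
    {x y : V → ℝ} (hxy : x ≤ y) (i : V) : Med W x i ≤ Med W y i := by
  rw [le_Med_iff hW y i]
  have hle : ∑ j with Med W x i ≤ x j, W i j ≤ ∑ j with Med W x i ≤ y j, W i j := by
    refine Finset.sum_le_sum_of_subset_of_nonneg ?_ fun j _ _ => hW.1 i j
    intro j hj
    simp only [mem_filter, mem_univ, true_and] at hj ⊢
    exact hj.trans (hxy j)
  rcases (le_Med_iff hW x i _).mp le_rfl with h | ⟨h, hi⟩
  · exact Or.inl (h.trans_le hle)
  · exact Or.inr ⟨h.trans hle, hi.trans (hxy i)⟩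

/-- One update of the dynamics, at node `i`. -/
noncomputable def medStep {V : Type*} [Fintype V] [DecidableEq V]
    (W : V → V → ℝ) (x : V → ℝ) (i : V) : V → ℝ :=
  Function.update x i (Med W x i)

lemma range_medStep_subset {V : Type*} [Fintype V] [DecidableEq V] {W : V → V → ℝ}
    (hW : RowStochastic W) (x : V → ℝ) (i : V) :
    Set.range (medStep W x i) ⊆ Set.range x := by
  rintro _ ⟨j, rfl⟩
  rcases eq_or_ne j i with rfl | hj
  · simpa [medStep] using (Med_spec hW x j).1.1
  · simp [medStep, hj]

lemma range_foldl_medStep_subset {V : Type*} [Fintype V] [DecidableEq V] {W : V → V → ℝ}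
    (hW : RowStochastic W) (l : List V) (x : V → ℝ) :
    Set.range (l.foldl (medStep W) x) ⊆ Set.range x := by
  induction l generalizing x with
  | nil => exact subset_rfl
  | cons i l ih => exact (ih _).trans (range_medStep_subset hW x i)

lemma finite_range_subset {V : Type*} [Finite V] (x : V → ℝ) :
    {y : V → ℝ | Set.range y ⊆ Set.range x}.Finite := by
  refine (Set.Finite.pi' fun _ : V => Set.finite_range x).subset ?_
  intro y hy i
  exact hy ⟨i, rfl⟩

lemma finite_reachable {V : Type*} [Fintype V] [DecidableEq V] {W : V → V → ℝ}
    (hW : RowStochastic W) (x : V → ℝ) :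
    (Set.range fun l : List V => l.foldl (medStep W) x).Finite := by
  refine (finite_range_subset x).subset ?_
  rintro _ ⟨l, rfl⟩
  exact range_foldl_medStep_subset hW l x

lemma Med_medStep_le {V : Type*} [Fintype V] [DecidableEq V] {W : V → V → ℝ}
    (hW : RowStochastic W) {x : V → ℝ} (hx : ∀ j, Med W x j ≤ x j) (i j : V) :
    Med W (medStep W x i) j ≤ medStep W x i j := by
  have hle : medStep W x i ≤ x := update_le_self_iff.mpr (hx i)
  have hmono := Med_mono hW hle j
  rcases eq_or_ne j i with rfl | hj
  · simpa [medStep] using hmono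
  · simpa [medStep, hj] using hmono.trans (hx j)

lemma Med_foldl_medStep_le {V : Type*} [Fintype V] [DecidableEq V] {W : V → V → ℝ}
    (hW : RowStochastic W) (l : List V) {x : V → ℝ} (hx : ∀ j, Med W x j ≤ x j) (j : V) :
    Med W (l.foldl (medStep W) x) j ≤ l.foldl (medStep W) x j := by
  induction l generalizing x with
  | nil => exact hx j
  | cons i l ih => exact ih (Med_medStep_le hW hx i)

/-- Every state can be steered to an equilibrium: first to a maximal reachable state, where no
opinion can increase any more, and from there to a minimal reachable state. -/
lemma exists_foldl_isEquilibrium {V : Type*} [Fintype V] [DecidableEq V] {W : V → V → ℝ}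
    (hW : RowStochastic W) (x : V → ℝ) :
    ∃ l : List V, IsEquilibrium W (l.foldl (medStep W) x) := by
  obtain ⟨_, ⟨l, rfl⟩, hmax⟩ := (finite_reachable hW x).exists_maximal (Set.range_nonempty _)
  set y := l.foldl (medStep W) x with hy
  have hdown : ∀ i, Med W y i ≤ y i := by
    intro i
    by_contra! hlt
    have hle : y ≤ medStep W y i := le_update_self_iff.mpr hlt.le
    have := hmax ⟨l ++ [i], by simp [hy]⟩ hle i
    simp only [medStep, Function.update_self] at this
    exact this.not_gt hlt
  obtain ⟨_, ⟨l', rfl⟩, hmin⟩ := (finite_reachable hW y).exists_minimal (Set.range_nonempty _)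
  refine ⟨l ++ l', fun i => ?_⟩
  rw [List.foldl_append, ← hy]
  set z := l'.foldl (medStep W) y with hz
  have hi : Med W z i ≤ z i := Med_foldl_medStep_le hW l' hdown i
  have hle : medStep W z i ≤ z := update_le_self_iff.mpr hi
  have := hmin ⟨l' ++ [i], by simp [hz]⟩ hle i
  simp only [medStep, Function.update_self] at this
  exact le_antisymm hi this

lemma IsEquilibrium.foldl_medStep {V : Type*} [Fintype V] [DecidableEq V] {W : V → V → ℝ}
    {x : V → ℝ} (hx : IsEquilibrium W x) (l : List V) : l.foldl (medStep W) x = x := by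
  induction l with
  | nil => rfl
  | cons i l ih => rwa [List.foldl_cons, medStep, hx i, Function.update_eq_self]

/-- A single word of updates steers every state of a finite set to an equilibrium. -/
lemma exists_common_foldl_isEquilibrium {V : Type*} [Fintype V] [DecidableEq V] {W : V → V → ℝ}
    (hW : RowStochastic W) {S : Set (V → ℝ)} (hS : S.Finite) :
    ∃ l : List V, ∀ x ∈ S, IsEquilibrium W (l.foldl (medStep W) x) := by
  induction S, hS using Set.Finite.induction_on with
  | empty => exact ⟨[], by simp⟩
  | @insert a S _ _ ih =>
    obtain ⟨l, hl⟩ := ih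
    obtain ⟨l', hl'⟩ := exists_foldl_isEquilibrium hW (l.foldl (medStep W) a)
    refine ⟨l ++ l', ?_⟩
    rintro x (rfl | hx)
    · rwa [List.foldl_append]
    · rw [List.foldl_append, (hl x hx).foldl_medStep]
      exact hl x hx

lemma traj_add_length {V : Type*} [Fintype V] [DecidableEq V] (W : V → V → ℝ) (u : ℕ → V)
    (x0 : V → ℝ) (l : List V) (t : ℕ) (h : ∀ j (hj : j < l.length), u (t + j) = l[j]) :
    traj W u x0 (t + l.length) = l.foldl (medStep W) (traj W u x0 t) := by
  induction l generalizing t with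
  | nil => rfl
  | cons i l ih =>
    have h0 : u t = i := h 0 (by simp)
    have hstep : traj W u x0 (t + 1) = medStep W (traj W u x0 t) i := by
      rw [traj, h0, medStep]
    rw [List.foldl_cons, ← hstep, ← ih (t + 1), List.length_cons, add_assoc, add_comm 1]
    intro j hj
    rw [add_assoc, add_comm 1]
    exact h (j + 1) (by simpa using hj)

lemma range_traj_subset {V : Type*} [Fintype V] [DecidableEq V] {W : V → V → ℝ}
    (hW : RowStochastic W) (u : ℕ → V) (x0 : V → ℝ) (t : ℕ) :
    Set.range (traj W u x0 t) ⊆ Set.range x0 := by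
  induction t with
  | zero => exact subset_rfl
  | succ t ih => exact (range_medStep_subset hW _ (u t)).trans ih

lemma traj_eq_of_isEquilibrium {V : Type*} [Fintype V] [DecidableEq V] {W : V → V → ℝ}
    {u : ℕ → V} {x0 : V → ℝ} {T : ℕ} (hT : IsEquilibrium W (traj W u x0 T)) {t : ℕ}
    (ht : T ≤ t) : traj W u x0 t = traj W u x0 T := by
  induction t, ht using Nat.le_induction with
  | base => rfl
  | succ t _ ih => rw [traj, ih, hT, Function.update_eq_self]

/-- Along an i.i.d. uniform sequence, almost surely infinitely many of the consecutive blocks of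
length `L` agree with `g`. -/
lemma measure_limsup_blocks_eq_one {n : ℕ} {μ : Measure (ℕ → Fin n)} (hμ : IIDUniform μ)
    (L : ℕ) (g : ℕ → Fin n) :
    μ (Filter.limsup (fun k => {u : ℕ → Fin n | ∀ t ∈ Finset.Ico (k * L) ((k + 1) * L),
      u t = g t}) Filter.atTop) = 1 := by
  have := hμ.1
  have hmeas : ∀ k, MeasurableSet {u : ℕ → Fin n | ∀ t ∈ Finset.Ico (k * L) ((k + 1) * L),
      u t = g t} := by
    intro k
    have : {u : ℕ → Fin n | ∀ t ∈ Finset.Ico (k * L) ((k + 1) * L), u t = g t} =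
        ⋂ t ∈ Finset.Ico (k * L) ((k + 1) * L), (fun u : ℕ → Fin n => u t) ⁻¹' {g t} := by
      ext u
      simp
    rw [this]
    exact Finset.measurableSet_biInter _ fun t _ =>
      measurable_pi_apply t (measurableSet_singleton _)
  have hcard : ∀ k, (Finset.Ico (k * L) ((k + 1) * L)).card = L := by
    intro k
    rw [Nat.card_Ico, add_mul, one_mul, Nat.add_sub_cancel_left]
  have hblock : ∀ k, μ {u : ℕ → Fin n | ∀ t ∈ Finset.Ico (k * L) ((k + 1) * L), u t = g t} =
      (1 / (n : ENNReal)) ^ L := by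
    intro k
    rw [hμ.2, hcard]
  refine ProbabilityTheory.measure_limsup_eq_one hmeas ?_ ?_
  · rw [ProbabilityTheory.iIndepSet_iff_meas_biInter hmeas]
    intro s
    have hinter : (⋂ k ∈ s, {u : ℕ → Fin n | ∀ t ∈ Finset.Ico (k * L) ((k + 1) * L), u t = g t}) =
        {u | ∀ t ∈ s.biUnion fun k => Finset.Ico (k * L) ((k + 1) * L), u t = g t} := by
      ext u
      simp only [Set.mem_iInter, Set.mem_ofPred_eq, Finset.mem_biUnion]
      exact ⟨fun h t ⟨k, hk, ht⟩ => h k hk t ht, fun h k hk t ht => h t ⟨k, hk, ht⟩⟩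
    have hdisj : ∀ a b, a < b →
        Disjoint (Finset.Ico (a * L) ((a + 1) * L)) (Finset.Ico (b * L) ((b + 1) * L)) :=
      fun a b hab => Finset.disjoint_left.mpr fun t hta htb =>
        ((Finset.mem_Ico.mp hta).2.trans_le
          ((Nat.mul_le_mul_right L hab).trans (Finset.mem_Ico.mp htb).1)).false
    rw [hinter, hμ.2, Finset.card_biUnion]
    · simp only [hblock, hcard, Finset.sum_const, Finset.prod_const, smul_eq_mul]
      rw [mul_comm, pow_mul]
    · intro a _ b _ hab
      rcases hab.lt_or_gt with h | h
      · exact hdisj a b h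
      · exact (hdisj b a h).symm
  · simp only [hblock]
    refine ENNReal.tsum_const_eq_top_of_ne_zero (pow_ne_zero _ ?_)
    simp

/-- almost-sure finite-time convergence: for any influence network and any
initial state, under the i.i.d. uniform random update sequence, almost surely the
weighted-median opinion dynamics converge to an equilibrium in finite time. -/
theorem almost_sure_finite_time_convergence (n : ℕ) (hn : 0 < n)
    (W : Fin n → Fin n → ℝ) (hW : RowStochastic W)
    (x0 : Fin n → ℝ) (μ : Measure (ℕ → Fin n)) (hμ : IIDUniform μ) :
    μ {u | ∃ T : ℕ, IsEquilibrium W (traj W u x0 T) ∧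
        ∀ t, T ≤ t → traj W u x0 t = traj W u x0 T} = 1 := by
  have := hμ.1
  obtain ⟨l, hl⟩ := exists_common_foldl_isEquilibrium hW (finite_range_subset x0)
  let g : ℕ → Fin n := fun t => l.getD (t % l.length) ⟨0, hn⟩
  refine le_antisymm prob_le_one ?_
  rw [← measure_limsup_blocks_eq_one hμ l.length g]
  refine measure_mono fun u hu => ?_
  rw [Filter.mem_limsup_iff_frequently_mem] at hu
  obtain ⟨k, hk⟩ := hu.exists
  have hword : ∀ j (hj : j < l.length), u (k * l.length + j) = l[j] := by
    intro j hj
    rw [hk _ (Finset.mem_Ico.mpr ⟨by omega, by rw [add_mul]; omega⟩)]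
    simp only [g]
    rw [Nat.mul_add_mod_of_lt hj, List.getD_eq_getElem _ _ hj]
  have heq : IsEquilibrium W (traj W u x0 (k * l.length + l.length)) := by
    rw [traj_add_length W u x0 l _ hword]
    exact hl _ (range_traj_subset hW u x0 _)
  exact ⟨_, heq, fun t ht => traj_eq_of_isEquilibrium heq ht⟩
end

section
/- Let a monotone NAE3SAT instance with n variables and m clauses be given, in which every variable index appears in at least one clause, and let G(W) be the associated sink–variable–clause (SVC) graph on 2n+m+1 nodes. Then the following are equivalent: (i) there exist a vector y ∈ {-1,0,1}^{2n+m+1} with exactly one zero entry and all other entries in {-1,1}, a time T ∈ ℕ, and an update sequence i_1, …, i_T such that the trajectory of the weighted-median opinion dynamics on G(W) started from y(0) = y satisfies y(T) = 0 (the all-zeros vector); (ii) the monotone NAE3SAT instance has a solution, i.e., there exists x ∈ {-1,1}^n such that for every clause j, the values x_{k_j^1}, x_{k_j^2}, x_{k_j^3} are not all equal. -/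
open Finset MeasureTheory

/-- The node set of the sink-variable-clause (SVC) graph: `Sum.inl ()` is the sink node `s`;
`Sum.inr (Sum.inl (i, false))` is the variable node `vᵢ`; `Sum.inr (Sum.inl (i, true))` is
the variable node `ṽᵢ`; `Sum.inr (Sum.inr j)` is the clause node `cⱼ`. -/
abbrev SVCNode (n m : ℕ) := Unit ⊕ (Fin n × Bool) ⊕ Fin m

/-- The row-stochastic weight matrix of the SVC graph associated with a monotone NAE3SAT
instance with `n` variables and `m` clauses, the clauses being `k j = (k j 0, k j 1, k j 2)`:
the sink has a self-loop of weight 1; `ṽᵢ` puts weight 1 on `vᵢ`; `vᵢ` puts weight 1/3 on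
each of itself, `ṽᵢ` and the last clause node `c_m`; clause node `cⱼ` puts weight 1/5 on each
of its three variable nodes (weights adding when indices coincide) and weight 2/5 on the
previous clause node (or on the sink if `j = 1`). -/
noncomputable def SVCWeight (n m : ℕ) (k : Fin m → Fin 3 → Fin n) :
    SVCNode n m → SVCNode n m → ℝ
  | Sum.inl _, Sum.inl _ => 1
  | Sum.inl _, _ => 0
  | Sum.inr (Sum.inl (i, true)), Sum.inr (Sum.inl (i', false)) => if i = i' then 1 else 0
  | Sum.inr (Sum.inl (_, true)), _ => 0
  | Sum.inr (Sum.inl (i, false)), Sum.inr (Sum.inl (i', _)) => if i = i' then 1 / 3 else 0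
  | Sum.inr (Sum.inl (_, false)), Sum.inr (Sum.inr j) => if (j : ℕ) = m - 1 then 1 / 3 else 0
  | Sum.inr (Sum.inl (_, false)), Sum.inl _ => 0
  | Sum.inr (Sum.inr j), Sum.inr (Sum.inl (i, false)) =>
      ((Finset.univ.filter (fun ℓ : Fin 3 => k j ℓ = i)).card : ℝ) / 5
  | Sum.inr (Sum.inr _), Sum.inr (Sum.inl (_, true)) => 0
  | Sum.inr (Sum.inr j), Sum.inr (Sum.inr j') => if (j' : ℕ) + 1 = (j : ℕ) then 2 / 5 else 0
  | Sum.inr (Sum.inr j), Sum.inl _ => if (j : ℕ) = 0 then 2 / 5 else 0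

section WeightedMedian

variable {V : Type*} [Fintype V]

theorem Med_mem_range (W : V → V → ℝ) (x : V → ℝ) (i : V) : ∃ a, x a = Med W x i := by
  unfold Med
  split_ifs with h
  · exact h.choose_spec.1.1
  · exact ⟨i, rfl⟩

/-- A value attained by `x` with less than half of the weight of row `i` strictly on either side
is the only weighted median, hence is `Med W x i`. -/
theorem Med_eq_of_sum_lt {W : V → V → ℝ} {x : V → ℝ} {i : V} (hnonneg : ∀ a, 0 ≤ W i a)
    (hsum : ∑ a, W i a = 1) {b : V}
    (hlt : ∑ a, W i a * (if x a < x b then 1 else 0) < 1 / 2)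
    (hgt : ∑ a, W i a * (if x b < x a then 1 else 0) < 1 / 2) :
    Med W x i = x b := by
  simp only [mul_ite, mul_one, mul_zero, ← Finset.sum_filter] at hlt hgt
  have huniq : ∀ r, IsWMedian x (W i) r → r = x b := by
    rintro r ⟨-, h1, h2⟩
    by_contra hne
    rcases lt_or_gt_of_ne hne with h | h
    · have hsplit := Finset.sum_filter_add_sum_filter_not Finset.univ (fun a => x a < x b) (W i)
      have hle : ∑ a ∈ Finset.univ.filter (fun a => ¬ x a < x b), W i a ≤
          ∑ a ∈ Finset.univ.filter (fun a => r < x a), W i a :=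
        Finset.sum_le_sum_of_subset_of_nonneg
          (Finset.monotone_filter_right _ fun a _ ha => h.trans_le (not_lt.mp ha))
          fun a _ _ => hnonneg a
      linarith
    · have hsplit := Finset.sum_filter_add_sum_filter_not Finset.univ (fun a => x b < x a) (W i)
      have hle : ∑ a ∈ Finset.univ.filter (fun a => ¬ x b < x a), W i a ≤
          ∑ a ∈ Finset.univ.filter (fun a => x a < r), W i a :=
        Finset.sum_le_sum_of_subset_of_nonneg
          (Finset.monotone_filter_right _ fun a _ ha => (not_lt.mp ha).trans_lt h)
          fun a _ _ => hnonneg a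
      linarith
  have hex : ∃ r, IsWMedian x (W i) r ∧ ∀ r', IsWMedian x (W i) r' → |r - x i| ≤ |r' - x i| :=
    ⟨x b, ⟨⟨b, rfl⟩, hlt.le, hgt.le⟩, fun r' h => by rw [huniq r' h]⟩
  unfold Med
  rw [dif_pos hex]
  exact huniq _ hex.choose_spec.1

variable [DecidableEq V]

/-- `z` is obtained from `x` by letting one node update its opinion. -/
def MedStep (W : V → V → ℝ) (x z : V → ℝ) : Prop :=
  ∃ i, z = Function.update x i (Med W x i)

theorem traj_congr (W : V → V → ℝ) {u u' : ℕ → V} (x : V → ℝ) {T : ℕ}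
    (h : ∀ t < T, u t = u' t) : traj W u x T = traj W u' x T := by
  induction T with
  | zero => rfl
  | succ T ih =>
    simp only [traj]
    rw [ih fun t ht => h t (ht.trans T.lt_succ_self), h T T.lt_succ_self]

theorem exists_traj_eq_of_reflTransGen {W : V → V → ℝ} {x z : V → ℝ} [Nonempty V]
    (h : Relation.ReflTransGen (MedStep W) x z) : ∃ T u, traj W u x T = z := by
  induction h with
  | refl => exact ⟨0, fun _ => Classical.arbitrary V, rfl⟩
  | tail _ hstep ih =>
    obtain ⟨T, u, rfl⟩ := ih
    obtain ⟨i, rfl⟩ := hstep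
    refine ⟨T + 1, fun t => if t < T then u t else i, ?_⟩
    have hcongr : traj W (fun t => if t < T then u t else i) x T = traj W u x T :=
      traj_congr W x fun t ht => if_pos ht
    simp only [traj, hcongr, lt_irrefl, if_false]

end WeightedMedian

section SVC

variable {n m : ℕ}

/-- The variable node `vᵢ`. -/
abbrev varNode (i : Fin n) : SVCNode n m := Sum.inr (Sum.inl (i, false))

/-- The variable node `ṽᵢ`. -/
abbrev shadowNode (i : Fin n) : SVCNode n m := Sum.inr (Sum.inl (i, true))

/-- The clause node `cⱼ`. -/
abbrev clauseNode (j : Fin m) : SVCNode n m := Sum.inr (Sum.inr j)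

/-- The node preceding `cⱼ` in the chain from the sink to the last clause node. -/
def prevNode (j : Fin m) : SVCNode n m :=
  if (j : ℕ) = 0 then Sum.inl () else clauseNode ⟨j - 1, by omega⟩

variable (k : Fin m → Fin 3 → Fin n)

theorem SVCWeight_nonneg (a b : SVCNode n m) : 0 ≤ SVCWeight n m k a b := by
  rcases a with _ | ⟨i, _ | _⟩ | j <;> rcases b with _ | ⟨i', _ | _⟩ | j' <;>
    simp only [SVCWeight] <;> positivity

theorem sum_SVCWeight_sink (f : SVCNode n m → ℝ) :
    ∑ a, SVCWeight n m k (Sum.inl ()) a * f a = f (Sum.inl ()) := by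
  simp [Fintype.sum_sum_type, SVCWeight]

theorem sum_SVCWeight_shadow (i : Fin n) (f : SVCNode n m → ℝ) :
    ∑ a, SVCWeight n m k (shadowNode i) a * f a = f (varNode i) := by
  simp [Fintype.sum_sum_type, Fintype.sum_prod_type, SVCWeight]

theorem sum_SVCWeight_var (hm : 0 < m) (i : Fin n) (f : SVCNode n m → ℝ) :
    ∑ a, SVCWeight n m k (varNode i) a * f a =
      (f (varNode i) + f (shadowNode i) + f (clauseNode ⟨m - 1, by omega⟩)) / 3 := by
  have hlast : ∀ j : Fin m, ((j : ℕ) = m - 1) = (j = ⟨m - 1, by omega⟩) := fun j => by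
    simp [Fin.ext_iff]
  simp [Fintype.sum_sum_type, Fintype.sum_prod_type, SVCWeight, hlast, Finset.sum_add_distrib]
  ring

theorem sum_SVCWeight_clause (j : Fin m) (f : SVCNode n m → ℝ) :
    ∑ a, SVCWeight n m k (clauseNode j) a * f a =
      (f (varNode (k j 0)) + f (varNode (k j 1)) + f (varNode (k j 2)) + 2 * f (prevNode j)) / 5 := by
  have hvar : ∑ i, (((Finset.univ.filter (fun ℓ : Fin 3 => k j ℓ = i)).card : ℝ) / 5) *
      f (varNode i) = (f (varNode (k j 0)) + f (varNode (k j 1)) + f (varNode (k j 2))) / 5 := by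
    simp only [Finset.card_filter, Fin.sum_univ_three]
    push_cast
    simp only [add_div, add_mul, Finset.sum_add_distrib, ite_div, ite_mul, zero_div, zero_mul,
      Finset.sum_ite_eq, Finset.mem_univ, if_true]
    ring
  by_cases hj : (j : ℕ) = 0
  · simp [Fintype.sum_sum_type, Fintype.sum_prod_type, SVCWeight, prevNode, hj, hvar]
    ring
  · have hprev : ∀ j' : Fin m, ((j' : ℕ) + 1 = j) = (j' = ⟨j - 1, by omega⟩) := fun j' => by
      simp only [Fin.ext_iff, eq_iff_iff]; omega
    simp [Fintype.sum_sum_type, Fintype.sum_prod_type, SVCWeight, prevNode, hj, hvar, hprev]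
    ring

theorem Med_SVC_sink (x : SVCNode n m → ℝ) :
    Med (SVCWeight n m k) x (Sum.inl ()) = x (Sum.inl ()) := by
  apply Med_eq_of_sum_lt (SVCWeight_nonneg k _)
  · simpa using sum_SVCWeight_sink k fun _ => 1
  all_goals rw [sum_SVCWeight_sink]; norm_num

theorem Med_SVC_shadow (x : SVCNode n m → ℝ) (i : Fin n) :
    Med (SVCWeight n m k) x (shadowNode i) = x (varNode i) := by
  apply Med_eq_of_sum_lt (SVCWeight_nonneg k _)
  · simpa using sum_SVCWeight_shadow k i fun _ => 1
  all_goals rw [sum_SVCWeight_shadow]; norm_num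

theorem sum_SVCWeight_var_eq_one (hm : 0 < m) (i : Fin n) :
    ∑ a, SVCWeight n m k (varNode i) a = 1 := by
  have h := sum_SVCWeight_var k hm i fun _ => 1
  simp only [mul_one] at h
  rw [h]
  norm_num

theorem sum_SVCWeight_clause_eq_one (j : Fin m) :
    ∑ a, SVCWeight n m k (clauseNode j) a = 1 := by
  have h := sum_SVCWeight_clause k j fun _ => 1
  simp only [mul_one] at h
  rw [h]
  norm_num

theorem Med_SVC_var_of_eq_shadow (hm : 0 < m) {x : SVCNode n m → ℝ} {i : Fin n}
    (h : x (shadowNode i) = x (varNode i)) :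
    Med (SVCWeight n m k) x (varNode i) = x (varNode i) := by
  apply Med_eq_of_sum_lt (SVCWeight_nonneg k _) (sum_SVCWeight_var_eq_one k hm i)
  all_goals
    rw [sum_SVCWeight_var k hm, h]
    simp only [lt_irrefl, if_false]
    split_ifs <;> norm_num

/-- When `vᵢ` and `ṽᵢ` hold opposite opinions, `vᵢ` adopts the opinion of the last clause node. -/
theorem Med_SVC_var_of_opposite (hm : 0 < m) {x : SVCNode n m → ℝ} {i : Fin n}
    (hv : x (varNode i) = -1 ∨ x (varNode i) = 1) (hs : x (shadowNode i) = -x (varNode i))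
    {j : Fin m} (hj : (j : ℕ) = m - 1)
    (hc : x (clauseNode j) = -1 ∨ x (clauseNode j) = 0 ∨ x (clauseNode j) = 1) :
    Med (SVCWeight n m k) x (varNode i) = x (clauseNode j) := by
  have hlast : (⟨m - 1, by omega⟩ : Fin m) = j := Fin.ext hj.symm
  apply Med_eq_of_sum_lt (SVCWeight_nonneg k _) (sum_SVCWeight_var_eq_one k hm i)
  all_goals
    rw [sum_SVCWeight_var k hm, hs, hlast]
    rcases hv with hv | hv <;> rcases hc with hc | hc | hc <;> rw [hv, hc] <;> norm_num

theorem Med_SVC_clause_of_nae {x : SVCNode n m → ℝ} {j : Fin m}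
    (hv : ∀ i, x (varNode i) = -1 ∨ x (varNode i) = 1) (hp : x (prevNode j) = 0)
    (hnae : ¬ (x (varNode (k j 0)) = x (varNode (k j 1)) ∧
      x (varNode (k j 1)) = x (varNode (k j 2)))) :
    Med (SVCWeight n m k) x (clauseNode j) = 0 := by
  rw [← hp]
  apply Med_eq_of_sum_lt (SVCWeight_nonneg k _) (sum_SVCWeight_clause_eq_one k j)
  all_goals
    rw [sum_SVCWeight_clause k, hp]
    rcases hv (k j 0) with h0 | h0 <;> rcases hv (k j 1) with h1 | h1 <;>
      rcases hv (k j 2) with h2 | h2 <;> rw [h0, h1, h2] at hnae ⊢ <;>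
      first | (norm_num; done) | simp at hnae

theorem nae_of_Med_SVC_clause_eq_zero {x : SVCNode n m → ℝ} {j : Fin m}
    (hv : ∀ i, x (varNode i) = -1 ∨ x (varNode i) = 1)
    (hp : x (prevNode j) = -1 ∨ x (prevNode j) = 0 ∨ x (prevNode j) = 1)
    (hmed : Med (SVCWeight n m k) x (clauseNode j) = 0) :
    x (prevNode j) = 0 ∧ ¬ (x (varNode (k j 0)) = x (varNode (k j 1)) ∧
      x (varNode (k j 1)) = x (varNode (k j 2))) := by
  have key : ∀ b : SVCNode n m, x b ≠ 0 →
      ∑ a, SVCWeight n m k (clauseNode j) a * (if x a < x b then 1 else 0) < 1 / 2 →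
      ¬ ∑ a, SVCWeight n m k (clauseNode j) a * (if x b < x a then 1 else 0) < 1 / 2 :=
    fun b hb hlt hgt => hb <| hmed ▸
      (Med_eq_of_sum_lt (SVCWeight_nonneg k _) (sum_SVCWeight_clause_eq_one k j) hlt hgt).symm
  have key0 := key (varNode (k j 0))
  have keyp := key (prevNode j)
  simp only [sum_SVCWeight_clause k] at key0 keyp
  rcases hv (k j 0) with h0 | h0 <;> rcases hv (k j 1) with h1 | h1 <;>
    rcases hv (k j 2) with h2 | h2 <;> rcases hp with hp | hp | hp <;>
    rw [h0, h1, h2, hp] at key0 keyp ⊢ <;>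
    first
      | (norm_num; done)
      | (norm_num at key0; done)
      | norm_num at keyp

/-- Clause `j` is satisfied, in the not-all-equal sense, by the assignment `x`. -/
def NAE (x : Fin n → ℝ) (j : Fin m) : Prop :=
  ¬ (x (k j 0) = x (k j 1) ∧ x (k j 1) = x (k j 2))

/-- The states that can still reach the zero consensus while not all clauses are known to be
satisfied by `x`: the variable nodes encode `x`, and a clause node is zero only if all clauses up
to it are satisfied. -/
structure Encodes (x : Fin n → ℝ) (z : SVCNode n m → ℝ) : Prop where
  ternary : ∀ a, z a = -1 ∨ z a = 0 ∨ z a = 1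
  var_eq : ∀ i, z (varNode i) = x i
  shadow_eq : ∀ i, z (shadowNode i) = -x i
  nae_of_clause_eq_zero : ∀ j, z (clauseNode j) = 0 → ∀ j' ≤ j, NAE k x j'

/-- Some pair `vᵢ`, `ṽᵢ` is stuck at a common nonzero opinion. -/
def Stuck (z : SVCNode n m → ℝ) : Prop :=
  ∃ i, z (shadowNode i) = z (varNode i) ∧ z (varNode i) ≠ 0

theorem Stuck.update (hm : 0 < m) {z : SVCNode n m → ℝ} (h : Stuck z) (a : SVCNode n m) :
    Stuck (Function.update z a (Med (SVCWeight n m k) z a)) := by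
  obtain ⟨i, hi, h0⟩ := h
  refine ⟨i, ?_⟩
  by_cases hv : a = varNode i
  · subst hv
    simp [Med_SVC_var_of_eq_shadow k hm hi, hi, h0]
  by_cases hs : a = shadowNode i
  · subst hs
    simp [Med_SVC_shadow, h0]
  · rw [Function.update_of_ne (Ne.symm hv), Function.update_of_ne (Ne.symm hs)]
    exact ⟨hi, h0⟩

theorem Encodes.update (hm : 0 < m) {x : Fin n → ℝ} (hx : ∀ i, x i = -1 ∨ x i = 1)
    {z : SVCNode n m → ℝ} (h : Encodes k x z) (a : SVCNode n m) :
    (∀ j, NAE k x j) ∨ Stuck (Function.update z a (Med (SVCWeight n m k) z a)) ∨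
      Encodes k x (Function.update z a (Med (SVCWeight n m k) z a)) := by
  have hx0 : ∀ i, x i ≠ 0 := fun i => by rcases hx i with h | h <;> rw [h] <;> norm_num
  have hternary : ∀ b, Function.update z a (Med (SVCWeight n m k) z a) b = -1 ∨
      Function.update z a (Med (SVCWeight n m k) z a) b = 0 ∨
      Function.update z a (Med (SVCWeight n m k) z a) b = 1 := fun b => by
    by_cases hb : b = a
    · subst hb
      obtain ⟨c, hc⟩ := Med_mem_range (SVCWeight n m k) z b
      rw [Function.update_self, ← hc]
      exact h.ternary c
    · rw [Function.update_of_ne hb]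
      exact h.ternary b
  rcases a with ⟨⟩ | ⟨i, _ | _⟩ | j
  · right; right
    rw [Med_SVC_sink, Function.update_eq_self]
    exact h
  · have hlast : m - 1 < m := by omega
    by_cases hc : z (clauseNode ⟨m - 1, hlast⟩) = 0
    · left
      exact fun j => h.nae_of_clause_eq_zero _ hc j (Fin.le_def.mpr (by simp only; omega))
    · right
      have hmed := Med_SVC_var_of_opposite k hm (i := i) (by rw [h.var_eq]; exact hx i)
        (by rw [h.shadow_eq, h.var_eq]) (j := ⟨m - 1, hlast⟩) rfl (h.ternary _)
      by_cases hcx : z (clauseNode ⟨m - 1, hlast⟩) = x i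
      · right
        rw [hmed, hcx, ← h.var_eq i, Function.update_eq_self]
        exact h
      · left
        have hcx' : z (clauseNode ⟨m - 1, hlast⟩) = -x i := by
          rcases h.ternary (clauseNode ⟨m - 1, hlast⟩) with h1 | h1 | h1 <;>
            rcases hx i with h2 | h2 <;> simp [h1, h2] at hc hcx ⊢
        refine ⟨i, ?_⟩
        simp [hmed, hcx', h.shadow_eq, hx0]
  · right; left
    refine ⟨i, ?_⟩
    simp [Med_SVC_shadow, h.var_eq, hx0]
  · right; right
    refine ⟨hternary, fun i => by simp [h.var_eq], fun i => by simp [h.shadow_eq], ?_⟩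
    intro j₁ hj₁
    by_cases hj : j₁ = j
    · subst hj
      rw [Function.update_self] at hj₁
      obtain ⟨hp, hnae⟩ := nae_of_Med_SVC_clause_eq_zero k
        (fun i => by rw [h.var_eq]; exact hx i) (h.ternary _) hj₁
      simp only [h.var_eq] at hnae
      intro j' hj'
      rcases hj'.eq_or_lt with rfl | hlt
      · exact hnae
      · have hne : (j₁ : ℕ) ≠ 0 := by have := Fin.lt_def.mp hlt; omega
        rw [prevNode, if_neg hne] at hp
        refine h.nae_of_clause_eq_zero _ hp j' (Fin.le_def.mpr ?_)
        have := Fin.lt_def.mp hlt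
        simp only
        omega
    · rw [Function.update_of_ne (by simpa using hj)] at hj₁
      exact h.nae_of_clause_eq_zero j₁ hj₁

theorem traj_SVC_sink (u : ℕ → SVCNode n m) (y : SVCNode n m → ℝ) (T : ℕ) :
    traj (SVCWeight n m k) u y T (Sum.inl ()) = y (Sum.inl ()) := by
  induction T with
  | zero => rfl
  | succ T ih =>
    rw [← ih, traj]
    by_cases h : u T = Sum.inl ()
    · rw [h, Function.update_self, Med_SVC_sink]
    · rw [Function.update_of_ne (Ne.symm h)]

theorem exists_nae_of_zero_consensus (hn : 0 < n) (hm : 0 < m) {y : SVCNode n m → ℝ}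
    (hy : ∃ a0, y a0 = 0 ∧ ∀ a, a ≠ a0 → (y a = -1 ∨ y a = 1)) {T : ℕ} {u : ℕ → SVCNode n m}
    (hT : ∀ a, traj (SVCWeight n m k) u y T a = 0) :
    ∃ x : Fin n → ℝ, (∀ i, x i = -1 ∨ x i = 1) ∧ ∀ j, NAE k x j := by
  obtain ⟨a0, ha0, hy⟩ := hy
  obtain rfl : a0 = Sum.inl () := by
    by_contra hne
    have hs := traj_SVC_sink k u y T
    rw [hT] at hs
    rcases hy _ (Ne.symm hne) with h | h <;> rw [h] at hs <;> norm_num at hs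
  have hpm : ∀ a, y (Sum.inr a) = -1 ∨ y (Sum.inr a) = 1 := fun a => hy _ (by simp)
  refine ⟨fun i => y (varNode i), fun i => hpm _, ?_⟩
  have hinit : Stuck y ∨ Encodes k (fun i => y (varNode i)) y := by
    rw [or_iff_not_imp_left]
    intro hstuck
    refine ⟨?_, fun _ => rfl, fun i => ?_, fun j hj => ?_⟩
    · rintro (⟨⟩ | a)
      · exact Or.inr (Or.inl ha0)
      · exact (hpm a).imp_right Or.inr
    · by_contra hne
      refine hstuck ⟨i, ?_⟩
      rcases hpm (.inl (i, false)) with h1 | h1 <;> rcases hpm (.inl (i, true)) with h2 | h2 <;>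
        simp only [h1, h2] at * <;> norm_num at *
    · rcases hpm (.inr j) with h | h <;> rw [h] at hj <;> norm_num at hj
  have hinv : ∀ t, (∀ j, NAE k (fun i => y (varNode i)) j) ∨
      Stuck (traj (SVCWeight n m k) u y t) ∨
      Encodes k (fun i => y (varNode i)) (traj (SVCWeight n m k) u y t) := by
    intro t
    induction t with
    | zero => exact Or.inr hinit
    | succ t ih =>
      rcases ih with h | h | h
      · exact Or.inl h
      · exact Or.inr (Or.inl (h.update k hm _))
      · exact h.update k hm (fun i => hpm _) _
  rcases hinv T with h | ⟨i, -, h⟩ | h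
  · exact h
  · exact absurd (hT _) h
  · have hv := h.var_eq ⟨0, hn⟩
    rw [hT] at hv
    rcases hpm (.inl (⟨0, hn⟩, false)) with h | h <;> rw [h] at hv <;> norm_num at hv

/-- The state in which the variable nodes encode the assignment `x`, except that the `vᵢ` with
`i < q`, the `ṽᵢ` with `i < r` and the `cⱼ` with `j < p` have already become zero. -/
def partialZero (x : Fin n → ℝ) (p q r : ℕ) : SVCNode n m → ℝ
  | Sum.inl _ => 0
  | Sum.inr (Sum.inl (i, false)) => if (i : ℕ) < q then 0 else x i
  | Sum.inr (Sum.inl (i, true)) => if (i : ℕ) < r then 0 else -x i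
  | Sum.inr (Sum.inr j) => if (j : ℕ) < p then 0 else 1

theorem medStep_partialZero_clause {x : Fin n → ℝ} (hx : ∀ i, x i = -1 ∨ x i = 1)
    (hnae : ∀ j, NAE k x j) {p : ℕ} (hp : p < m) :
    MedStep (SVCWeight n m k) (partialZero x p 0 0) (partialZero x (p + 1) 0 0) := by
  refine ⟨clauseNode ⟨p, hp⟩, ?_⟩
  rw [Med_SVC_clause_of_nae k (fun i => by simpa [partialZero] using hx i) ?_
    (by simpa [partialZero, NAE] using hnae ⟨p, hp⟩)]
  · funext a
    rcases a with _ | ⟨i, _ | _⟩ | j <;>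
      simp [partialZero, Function.update_apply, Fin.ext_iff, Order.lt_add_one_iff]
    grind
  · unfold prevNode
    split_ifs with h
    · rfl
    · simp only at h
      simp only [partialZero]
      exact if_pos (by omega)

theorem medStep_partialZero_var {x : Fin n → ℝ} (hx : ∀ i, x i = -1 ∨ x i = 1) (hm : 0 < m)
    {q : ℕ} (hq : q < n) :
    MedStep (SVCWeight n m k) (partialZero x m q 0) (partialZero x m (q + 1) 0) := by
  refine ⟨varNode ⟨q, hq⟩, ?_⟩
  rw [Med_SVC_var_of_opposite k hm (by simpa [partialZero] using hx _) (by simp [partialZero])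
    (j := ⟨m - 1, by omega⟩) rfl (by simp [partialZero, hm])]
  funext a
  rcases a with _ | ⟨i, _ | _⟩ | j <;>
    simp [partialZero, Function.update_apply, Fin.ext_iff, Order.lt_add_one_iff, hm]
  grind

theorem medStep_partialZero_shadow (x : Fin n → ℝ) {r : ℕ} (hr : r < n) :
    MedStep (SVCWeight n m k) (partialZero x m n r) (partialZero x m n (r + 1)) := by
  refine ⟨shadowNode ⟨r, hr⟩, ?_⟩
  rw [Med_SVC_shadow]
  funext a
  rcases a with _ | ⟨i, _ | _⟩ | j <;>
    simp [partialZero, Function.update_apply, Fin.ext_iff, Order.lt_add_one_iff, hr]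
  grind

theorem reflTransGen_of_forall_lt_succ {α : Type*} {R : α → α → Prop} (f : ℕ → α) {N : ℕ}
    (h : ∀ i < N, R (f i) (f (i + 1))) : Relation.ReflTransGen R (f 0) (f N) := by
  induction N with
  | zero => exact .refl
  | succ N ih => exact (ih fun i hi => h i (hi.trans N.lt_succ_self)).tail (h N N.lt_succ_self)

theorem zero_consensus_reachable_of_nae (hm : 0 < m) {x : Fin n → ℝ}
    (hx : ∀ i, x i = -1 ∨ x i = 1) (hnae : ∀ j, NAE k x j) :
    Relation.ReflTransGen (MedStep (SVCWeight n m k)) (partialZero x 0 0 0)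
      (partialZero x m n n) :=
  ((reflTransGen_of_forall_lt_succ (fun p => partialZero x p 0 0)
      fun _ hp => medStep_partialZero_clause k hx hnae hp).trans
    (reflTransGen_of_forall_lt_succ (fun q => partialZero x m q 0)
      fun _ hq => medStep_partialZero_var k hx hm hq)).trans
    (reflTransGen_of_forall_lt_succ (fun r => partialZero x m n r)
      fun _ hr => medStep_partialZero_shadow k x hr)

end SVC

/-- for the SVC graph of a monotone NAE3SAT instance (in which every variable
appears in some clause and no clause has its three indices all equal), the weighted-median
opinion dynamics can be driven from some almost-ternary state (exactly one zero entry, all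
other entries in `{-1, 1}`) to the all-zeros consensus by some finite update sequence iff
the NAE3SAT instance has a solution. -/
theorem svc_zero_consensus_iff_nae3sat (n m : ℕ) (hn : 0 < n) (hm : 0 < m)
    (k : Fin m → Fin 3 → Fin n)
    (hk : ∀ j, ¬ (k j 0 = k j 1 ∧ k j 1 = k j 2))
    (hcover : ∀ i : Fin n, ∃ j ℓ, k j ℓ = i) :
    (∃ y : SVCNode n m → ℝ,
        (∃ a0 : SVCNode n m, y a0 = 0 ∧ ∀ a, a ≠ a0 → (y a = -1 ∨ y a = 1)) ∧
        ∃ (T : ℕ) (u : ℕ → SVCNode n m),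
          ∀ a, traj (SVCWeight n m k) u y T a = 0) ↔
      (∃ x : Fin n → ℝ, (∀ i, x i = -1 ∨ x i = 1) ∧
        ∀ j, ¬ (x (k j 0) = x (k j 1) ∧ x (k j 1) = x (k j 2))) := by
  constructor
  · rintro ⟨y, hy, T, u, hT⟩
    exact exists_nae_of_zero_consensus k hn hm hy hT
  · rintro ⟨x, hx, hnae⟩
    obtain ⟨T, u, hT⟩ :=
      exists_traj_eq_of_reflTransGen (zero_consensus_reachable_of_nae k hm hx hnae)
    refine ⟨partialZero x 0 0 0, ⟨Sum.inl (), rfl, ?_⟩, T, u, fun a => ?_⟩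
    · rintro (⟨⟩ | ⟨i, _ | _⟩ | j) ha
      · exact absurd rfl ha
      · simpa [partialZero] using hx i
      · rcases hx i with h | h <;> simp [partialZero, h]
      · simp [partialZero]
    · rw [hT]
      rcases a with _ | ⟨i, _ | _⟩ | j <;> simp [partialZero]
end
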